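/- For every real 1 ≤ q < 3 there is a constant C = C(q) > 0 such that for all ε > 0, α > 1 and z ∈ ℝ³, ∫_{{x ∈ ℝ³ : ε < |x| < αε}} ‖DΨ_{ε,α}[z](x)‖^q dx ≤ C |z|^q · (α^{3−q} − 1) ε^{3−q} / ((3−q) (log α)^q), where DΨ denotes the Fréchet derivative of Ψ_{ε,α}[z] on the annulus and ‖·‖ the operator norm (one may take C = 5^q · 4π). -/

import Mathlib

open MeasureTheory

/-- The radial cut-off profile `f_{A,B}`. -/
noncomputable def fAB (A B : ℝ) (z : ℝ) : ℝ :=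
  if z < A then 1
  else if z ≤ B then (Real.log z - Real.log B) / (Real.log A - Real.log B)
  else 0

/-- The cut-off `η_{ε,α}(x) = f_{ε,αε}(|x|)` on `ℝ^d`. -/
noncomputable def eta (d : ℕ) (ε α : ℝ) (x : EuclideanSpace ℝ (Fin d)) : ℝ :=
  fAB ε (α * ε) ‖x‖

/-- The auxiliary field `v_z(x) = (z₂x₃, z₃x₁, z₁x₂)` (1-based indices). -/
noncomputable def vz (z x : EuclideanSpace ℝ (Fin 3)) : EuclideanSpace ℝ (Fin 3) :=
  (WithLp.equiv 2 (Fin 3 → ℝ)).symm ![z 1 * x 2, z 2 * x 0, z 0 * x 1]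

/-- Cross product of two vectors of `ℝ³`. -/
noncomputable def cross3 (a b : EuclideanSpace ℝ (Fin 3)) : EuclideanSpace ℝ (Fin 3) :=
  (WithLp.equiv 2 (Fin 3 → ℝ)).symm
    ![a 1 * b 2 - a 2 * b 1, a 2 * b 0 - a 0 * b 2, a 0 * b 1 - a 1 * b 0]

/-- The gradient `∇η_{ε,α}(x) = -x/(|x|² log α)` on the annulus. -/
noncomputable def gradEta3 (α : ℝ) (x : EuclideanSpace ℝ (Fin 3)) : EuclideanSpace ℝ (Fin 3) :=
  -(1 / (‖x‖ ^ 2 * Real.log α)) • x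

/-- The divergence-free cut-off field `Ψ_{ε,α}[z]` in dimension 3:
equal to `z` for `|x| ≤ ε`, to `η_{ε,α} z + ∇η_{ε,α} × v_z` for `ε < |x| < αε`,
and to `0` for `|x| ≥ αε`. -/
noncomputable def Psi3 (ε α : ℝ) (z x : EuclideanSpace ℝ (Fin 3)) : EuclideanSpace ℝ (Fin 3) :=
  if ‖x‖ ≤ ε then z
  else if ‖x‖ < α * ε then eta 3 ε α x • z + cross3 (gradEta3 α x) (vz z x)
  else 0

/-- Curl of a vector field on `ℝ³`, via Fréchet derivatives in coordinate directions. -/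
noncomputable def curl3 (F : EuclideanSpace ℝ (Fin 3) → EuclideanSpace ℝ (Fin 3))
    (x : EuclideanSpace ℝ (Fin 3)) : EuclideanSpace ℝ (Fin 3) :=
  (WithLp.equiv 2 (Fin 3 → ℝ)).symm
    ![fderiv ℝ F x (EuclideanSpace.single 1 1) 2 - fderiv ℝ F x (EuclideanSpace.single 2 1) 1,
      fderiv ℝ F x (EuclideanSpace.single 2 1) 0 - fderiv ℝ F x (EuclideanSpace.single 0 1) 2,
      fderiv ℝ F x (EuclideanSpace.single 0 1) 1 - fderiv ℝ F x (EuclideanSpace.single 1 1) 0]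

/-- Divergence of a vector field on `ℝ³`. -/
noncomputable def div3 (F : EuclideanSpace ℝ (Fin 3) → EuclideanSpace ℝ (Fin 3))
    (x : EuclideanSpace ℝ (Fin 3)) : ℝ :=
  ∑ i, fderiv ℝ F x (EuclideanSpace.single i 1) i


lemma aux_norm_sq (x : EuclideanSpace ℝ (Fin 3)) : ‖x‖ ^ 2 = x 0 ^ 2 + x 1 ^ 2 + x 2 ^ 2 := by
  rw [EuclideanSpace.real_norm_sq_eq, Fin.sum_univ_three]

lemma aux_cross_le (a b : EuclideanSpace ℝ (Fin 3)) : ‖cross3 a b‖ ≤ ‖a‖ * ‖b‖ := by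
  apply le_of_sq_le_sq _ (by positivity)
  rw [mul_pow, aux_norm_sq, aux_norm_sq, aux_norm_sq]
  simp only [cross3, WithLp.equiv_symm_apply, Matrix.cons_val_zero, Matrix.cons_val_one,
    Matrix.cons_val]
  nlinarith [sq_nonneg (a 0 * b 0 + a 1 * b 1 + a 2 * b 2)]

lemma aux_vz_le (z x : EuclideanSpace ℝ (Fin 3)) : ‖vz z x‖ ≤ ‖z‖ * ‖x‖ := by
  apply le_of_sq_le_sq _ (by positivity)
  rw [mul_pow, aux_norm_sq, aux_norm_sq, aux_norm_sq]
  simp only [vz, WithLp.equiv_symm_apply, Matrix.cons_val_zero, Matrix.cons_val_one,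
    Matrix.cons_val]
  have := fun i j => sq_nonneg (z i * x j)
  nlinarith [this 0 0, this 0 1, this 0 2, this 1 0, this 1 1, this 1 2, this 2 0, this 2 1,
    this 2 2]

lemma aux_B_le (z x y : EuclideanSpace ℝ (Fin 3)) : ‖cross3 x (vz z y)‖ ≤ ‖z‖ * ‖x‖ * ‖y‖ := by
  calc _ ≤ ‖x‖ * ‖vz z y‖ := aux_cross_le _ _
    _ ≤ ‖x‖ * (‖z‖ * ‖y‖) := by gcongr; exact aux_vz_le _ _
    _ = _ := by ring

lemma aux_bil (z : EuclideanSpace ℝ (Fin 3)) : IsBoundedBilinearMap ℝ (fun p : EuclideanSpace ℝ (Fin 3) × EuclideanSpace ℝ (Fin 3) => cross3 p.1 (vz z p.2)) where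
  add_left x y w := by
    ext i; fin_cases i <;> simp [cross3, vz] <;> ring
  smul_left c x y := by
    ext i; fin_cases i <;> simp [cross3, vz] <;> ring
  add_right x y w := by
    ext i; fin_cases i <;> simp [cross3, vz] <;> ring
  smul_right c x y := by
    ext i; fin_cases i <;> simp [cross3, vz] <;> ring
  bound := by
    refine ⟨‖z‖ + 1, by positivity, fun x y => (aux_B_le z x y).trans ?_⟩
    gcongr
    linarith

lemma aux_Psi_eq (ε α : ℝ) (hε : 0 < ε) (hα : 1 < α) (z x : EuclideanSpace ℝ (Fin 3)) (h1 : ε < ‖x‖)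
    (h2 : ‖x‖ < α * ε) :
    Psi3 ε α z x = (-(Real.log α)⁻¹) • ((Real.log (‖x‖ ^ 2) / 2 - Real.log (α * ε)) • z
      + (‖x‖ ^ 2)⁻¹ • cross3 x (vz z x)) := by
  have hl : 0 < Real.log α := Real.log_pos hα
  have hc : cross3 (gradEta3 α x) (vz z x)
      = (-(Real.log α)⁻¹ * (‖x‖ ^ 2)⁻¹) • cross3 x (vz z x) := by
    ext i; fin_cases i <;> simp [cross3, gradEta3] <;> ring
  rw [Psi3, if_neg (not_le.2 h1), if_pos h2, eta, fAB, if_neg (not_lt.2 h1.le), if_pos h2.le, hc,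
    smul_add, smul_smul, smul_smul]
  congr 2
  rw [Real.log_mul (by positivity) hε.ne', Real.log_pow]
  field_simp
  push_cast
  ring_nf
  field_simp
  ring

lemma aux_deriv (ε α : ℝ) (hε : 0 < ε) (hα : 1 < α) (z x : EuclideanSpace ℝ (Fin 3)) (h1 : ε < ‖x‖)
    (h2 : ‖x‖ < α * ε) :
    ‖fderiv ℝ (Psi3 ε α z) x‖ ≤ (5 * ‖z‖ / Real.log α) * ‖x‖⁻¹ := by
  have hl : 0 < Real.log α := Real.log_pos hα
  have hx : 0 < ‖x‖ := hε.trans h1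
  have hev : Psi3 ε α z =ᶠ[nhds x] fun x => (-(Real.log α)⁻¹) •
      ((Real.log (‖x‖ ^ 2) / 2 - Real.log (α * ε)) • z
      + (‖x‖ ^ 2)⁻¹ • cross3 x (vz z x)) := by
    filter_upwards [(isOpen_lt continuous_const continuous_norm).mem_nhds h1,
      (isOpen_lt continuous_norm continuous_const).mem_nhds h2] with y hy1 hy2
    exact aux_Psi_eq ε α hε hα z y hy1 hy2
  have hn : HasFDerivAt (fun x : EuclideanSpace ℝ (Fin 3) => ‖x‖ ^ 2) (2 • innerSL ℝ x) x :=
    (hasStrictFDerivAt_norm_sq x).hasFDerivAt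
  have hB : HasFDerivAt (fun x : EuclideanSpace ℝ (Fin 3) => cross3 x (vz z x)) _ x :=
    HasFDerivAt.comp (f := fun x : EuclideanSpace ℝ (Fin 3) => (x, x)) x ((aux_bil z).hasFDerivAt (x, x))
      ((hasFDerivAt_id x).prodMk (hasFDerivAt_id x))
  have hlog := ((hn.log (by positivity)).mul_const (2⁻¹ : ℝ)).sub_const (Real.log (α * ε))
  have hinv := (hasDerivAt_inv (x := ‖x‖ ^ 2) (by positivity)).comp_hasFDerivAt x hn
  have hF := ((hlog.smul_const z).add (hinv.smul hB)).const_smul (-(Real.log α)⁻¹)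
  rw [(hF.congr_of_eventuallyEq (hev.trans (.of_eq (by ext1; simp [div_eq_mul_inv])))).fderiv]
  refine ContinuousLinearMap.opNorm_le_bound _ (by positivity) fun h => ?_
  have hin : |inner ℝ x h| ≤ ‖x‖ * ‖h‖ := abs_real_inner_le_norm x h
  have e1 := aux_B_le z x h
  have e2 := aux_B_le z h x
  have e3 := aux_B_le z x x
  have key : ∀ L : EuclideanSpace ℝ (Fin 3), L = (-(Real.log α)⁻¹) • (((‖x‖ ^ 2)⁻¹ * inner ℝ x h) • z
      + ((‖x‖ ^ 2)⁻¹ • (cross3 x (vz z h) + cross3 h (vz z x))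
        + (-((‖x‖ ^ 2) ^ 2)⁻¹ * (2 * inner ℝ x h)) • cross3 x (vz z x))) →
      ‖L‖ ≤ 5 * ‖z‖ / Real.log α * ‖x‖⁻¹ * ‖h‖ := by
    rintro L rfl
    rw [norm_smul, norm_neg, norm_inv, Real.norm_of_nonneg hl.le]
    have a1 : ‖((‖x‖ ^ 2)⁻¹ * inner ℝ x h) • z‖ ≤ ‖z‖ * ‖x‖⁻¹ * ‖h‖ := by
      rw [norm_smul, norm_mul, Real.norm_of_nonneg (by positivity), Real.norm_eq_abs]
      calc _ ≤ (‖x‖ ^ 2)⁻¹ * (‖x‖ * ‖h‖) * ‖z‖ := by gcongr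
        _ = _ := by field_simp
    have a2 : ‖(‖x‖ ^ 2)⁻¹ • (cross3 x (vz z h) + cross3 h (vz z x))‖
        ≤ 2 * (‖z‖ * ‖x‖⁻¹ * ‖h‖) := by
      rw [norm_smul, Real.norm_of_nonneg (by positivity)]
      calc _ ≤ (‖x‖ ^ 2)⁻¹ * (‖z‖ * ‖x‖ * ‖h‖ + ‖z‖ * ‖h‖ * ‖x‖) := by
            gcongr
            exact norm_add_le_of_le e1 e2
        _ = _ := by field_simp; ring
    have a3 : ‖(-((‖x‖ ^ 2) ^ 2)⁻¹ * (2 * inner ℝ x h)) • cross3 x (vz z x)‖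
        ≤ 2 * (‖z‖ * ‖x‖⁻¹ * ‖h‖) := by
      rw [norm_smul, norm_mul, norm_neg, Real.norm_of_nonneg (by positivity), norm_mul,
        Real.norm_of_nonneg zero_le_two, Real.norm_eq_abs]
      calc _ ≤ ((‖x‖ ^ 2) ^ 2)⁻¹ * (2 * (‖x‖ * ‖h‖)) * (‖z‖ * ‖x‖ * ‖x‖) := by gcongr
        _ = _ := by field_simp
    calc _ ≤ (Real.log α)⁻¹ * (‖z‖ * ‖x‖⁻¹ * ‖h‖ + (2 * (‖z‖ * ‖x‖⁻¹ * ‖h‖)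
          + 2 * (‖z‖ * ‖x‖⁻¹ * ‖h‖))) := by
          gcongr
          exact norm_add_le_of_le a1 (norm_add_le_of_le a2 a3)
      _ = _ := by field_simp; ring
  apply key
  simp
  try module

lemma aux_radial (q : ℝ) (hq3 : q < 3) (ε α : ℝ) (hε : 0 < ε) (hα : 1 < α) :
    IntegrableOn (fun x : EuclideanSpace ℝ (Fin 3) => ‖x‖ ^ (-q)) {x | ε < ‖x‖ ∧ ‖x‖ < α * ε} ∧
    ∫ x in {x : EuclideanSpace ℝ (Fin 3) | ε < ‖x‖ ∧ ‖x‖ < α * ε}, ‖x‖ ^ (-q)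
      = 3 * (volume : Measure (EuclideanSpace ℝ (Fin 3))).real (Metric.ball 0 1)
        * ((α ^ (3 - q) - 1) * ε ^ (3 - q) / (3 - q)) := by
  have hm : MeasurableSet {x : EuclideanSpace ℝ (Fin 3) | ε < ‖x‖ ∧ ‖x‖ < α * ε} :=
    ((isOpen_lt continuous_const continuous_norm).inter
      (isOpen_lt continuous_norm continuous_const)).measurableSet
  constructor
  · have hK : IsCompact {x : EuclideanSpace ℝ (Fin 3) | ε ≤ ‖x‖ ∧ ‖x‖ ≤ α * ε} := by
      refine (isCompact_closedBall (0 : EuclideanSpace ℝ (Fin 3)) (α * ε)).of_isClosed_subset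
        ((isClosed_le continuous_const continuous_norm).inter
          (isClosed_le continuous_norm continuous_const)) fun x hx => ?_
      simpa using hx.2
    refine (ContinuousOn.integrableOn_compact hK ?_).mono_set fun x hx => ⟨hx.1.le, hx.2.le⟩
    exact continuous_norm.continuousOn.rpow_const fun x hx => Or.inl (hε.trans_le hx.1).ne'
  · have h := integral_fun_norm_addHaar (volume : Measure (EuclideanSpace ℝ (Fin 3)))
      ((Set.Ioo ε (α * ε)).indicator fun y : ℝ => y ^ (-q))
    rw [← integral_indicator hm]
    have e : ({x : EuclideanSpace ℝ (Fin 3) | ε < ‖x‖ ∧ ‖x‖ < α * ε}.indicator fun x : EuclideanSpace ℝ (Fin 3) => ‖x‖ ^ (-q))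
        = fun x : EuclideanSpace ℝ (Fin 3) => (Set.Ioo ε (α * ε)).indicator (fun y : ℝ => y ^ (-q)) ‖x‖ := by
      ext x; simp [Set.indicator_apply]
    have hle : ε ≤ α * ε := by nlinarith
    have e2 : ∫ y in Set.Ioi (0:ℝ), y ^ 2 • (Set.Ioo ε (α * ε)).indicator (fun y : ℝ => y ^ (-q)) y
        = (α ^ (3 - q) - 1) * ε ^ (3 - q) / (3 - q) := by
      calc _ = ∫ y in Set.Ioi (0:ℝ), (Set.Ioo ε (α * ε)).indicator (fun y : ℝ => y ^ (2 - q)) y := by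
            refine setIntegral_congr_fun measurableSet_Ioi fun y hy => ?_
            have hy : 0 < y := hy
            simp only [Set.indicator_apply, smul_eq_mul]
            split_ifs
            · rw [← Real.rpow_natCast, ← Real.rpow_add hy]; norm_num; ring_nf
            · simp
        _ = ∫ y in ε..(α * ε), y ^ (2 - q) := by
            rw [setIntegral_indicator measurableSet_Ioo, intervalIntegral.integral_of_le hle,
              integral_Ioc_eq_integral_Ioo, Set.inter_eq_right.2]
            exact fun y hy => hε.trans hy.1
        _ = _ := by
            rw [integral_rpow (Or.inl (by linarith)), Real.mul_rpow (by linarith) hε.le]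
            ring_nf
    rw [e, h, finrank_euclideanSpace_fin]
    simp only [Nat.add_one_sub_one, Nat.reduceSub, smul_eq_mul, nsmul_eq_mul] at e2 ⊢
    rw [e2]
    push_cast
    ring

/-- For `1 ≤ q < 3` there is `C = C(q) > 0` (e.g. `C = 5^q·4π`) with
`∫_{ε<|x|<αε} ‖DΨ_{ε,α}[z]‖^q dx ≤ C |z|^q (α^{3−q} − 1) ε^{3−q}/((3−q)(log α)^q)`. -/
theorem Psi3_deriv_Lq_bound (q : ℝ) (hq1 : 1 ≤ q) (hq3 : q < 3) :
    ∃ C : ℝ, 0 < C ∧ ∀ ε α : ℝ, 0 < ε → 1 < α → ∀ z : EuclideanSpace ℝ (Fin 3),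
      (∫ x in {x : EuclideanSpace ℝ (Fin 3) | ε < ‖x‖ ∧ ‖x‖ < α * ε},
          ‖fderiv ℝ (Psi3 ε α z) x‖ ^ q)
        ≤ C * ‖z‖ ^ q * ((α ^ (3 - q) - 1) * ε ^ (3 - q) / ((3 - q) * Real.log α ^ q)) := by
  have hv : 0 < (volume : Measure (EuclideanSpace ℝ (Fin 3))).real (Metric.ball 0 1) :=
    ENNReal.toReal_pos (Metric.measure_ball_pos _ _ one_pos).ne' measure_ball_lt_top.ne
  refine ⟨5 ^ q * (3 * (volume : Measure (EuclideanSpace ℝ (Fin 3))).real (Metric.ball 0 1)),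
    by positivity, fun ε α hε hα z => ?_⟩
  obtain ⟨hi, he⟩ := aux_radial q hq3 ε α hε hα
  have hl : 0 < Real.log α := Real.log_pos hα
  have hm : MeasurableSet {x : EuclideanSpace ℝ (Fin 3) | ε < ‖x‖ ∧ ‖x‖ < α * ε} :=
    ((isOpen_lt continuous_const continuous_norm).inter
      (isOpen_lt continuous_norm continuous_const)).measurableSet
  calc _ ≤ ∫ x in {x : EuclideanSpace ℝ (Fin 3) | ε < ‖x‖ ∧ ‖x‖ < α * ε},
          (5 * ‖z‖ / Real.log α) ^ q * ‖x‖ ^ (-q) := by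
        refine integral_mono_of_nonneg (.of_forall fun x => by positivity) (hi.const_mul _) ?_
        filter_upwards [ae_restrict_mem hm] with x hx
        have hx0 : 0 < ‖x‖ := hε.trans hx.1
        rw [Real.rpow_neg hx0.le, ← Real.inv_rpow hx0.le,
          ← Real.mul_rpow (by positivity) (by positivity)]
        exact Real.rpow_le_rpow (norm_nonneg _) (aux_deriv ε α hε hα z x hx.1 hx.2) (by linarith)
    _ = _ := by
        rw [integral_const_mul, he, Real.div_rpow (by positivity) hl.le,
          Real.mul_rpow (by norm_num) (norm_nonneg _)]
        have : Real.log α ^ q ≠ 0 := by positivity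
        have : 3 - q ≠ 0 := by linarith
        field_simp
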